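/- Let φ > 1 be a smooth, even function on 𝕊ⁿ with A[φ] ≥ 0 (in particular, the horospherical support function φ = e^u of a smooth, origin-symmetric, uniformly h-convex hypersurface in hyperbolic space ℍ^{n+1}). Then for every x ∈ 𝕊ⁿ, |Dφ|²/φ² ≤ 1 − 1/φ² ≤ 1. -/

import Mathlib

open scoped RealInnerProductSpace
open Finset

noncomputable section

/-- Euclidean space `ℝ^(n+1)`, the ambient space of the unit sphere `𝕊ⁿ`. -/
abbrev Euc (n : ℕ) : Type := EuclideanSpace ℝ (Fin (n + 1))

/-- The unit sphere `𝕊ⁿ ⊆ ℝ^(n+1)`. -/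
def uSphere (n : ℕ) : Set (Euc n) := Metric.sphere (0 : Euc n) 1

/-- Orthogonal projection onto the tangent space of the sphere at (the normalization of) `x`. -/
def tanProj {n : ℕ} (x v : Euc n) : Euc n := v - (⟪x, v⟫ / ‖x‖ ^ 2) • x

/-- `f` is (the 0-homogeneous extension of) a function on the sphere. -/
def Homog0 {n : ℕ} (f : Euc n → ℝ) : Prop := ∀ (c : ℝ) (y : Euc n), 0 < c → f (c • y) = f y

/-- Smoothness of a function on the sphere, expressed via its 0-homogeneous extension. -/
def SmoothFn {n : ℕ} (f : Euc n → ℝ) : Prop := ContDiffOn ℝ (⊤ : ℕ∞) f {y : Euc n | y ≠ 0}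

/-- `f(x) = f(-x)` for all `x`. -/
def EvenFn {n : ℕ} (f : Euc n → ℝ) : Prop := ∀ y, f (-y) = f y

/-- Covariant (tangential) derivative of a function on the sphere, in direction `v`. -/
def covD {n : ℕ} (f : Euc n → ℝ) (x v : Euc n) : ℝ := fderiv ℝ f x (tanProj x v)

/-- Spherical (tangential) gradient. -/
def gradS {n : ℕ} (f : Euc n → ℝ) (x : Euc n) : Euc n := tanProj x (gradient f x)

/-- Covariant Hessian `(D²f)(v,w)` of a function on the round sphere. -/
def hessS {n : ℕ} (f : Euc n → ℝ) (x v w : Euc n) : ℝ :=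
  fderiv ℝ (fun y => covD f y w) x (tanProj x v)

/-- The symmetric 2-tensor
`A[φ](v,w) = (D²φ)(v,w) - (|Dφ|²/(2φ)) σ(v,w) + ((φ - 1/φ)/2) σ(v,w)` on the sphere. -/
def Aform {n : ℕ} (φ : Euc n → ℝ) (x v w : Euc n) : ℝ :=
  hessS φ x v w +
    ((φ x - (φ x)⁻¹) / 2 - ‖gradS φ x‖ ^ 2 / (2 * φ x)) * ⟪tanProj x v, tanProj x w⟫

/-- `φ` is h-convex: `A[φ] ≥ 0` on the sphere. -/
def HConvex {n : ℕ} (φ : Euc n → ℝ) : Prop :=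
  ∀ x ∈ uSphere n, ∀ v : Euc n, ⟪x, v⟫ = 0 → 0 ≤ Aform φ x v v

/-- `φ` is uniformly h-convex: `A[φ] > 0` on the sphere. -/
def UnifHConvex {n : ℕ} (φ : Euc n → ℝ) : Prop :=
  ∀ x ∈ uSphere n, ∀ v : Euc n, ⟪x, v⟫ = 0 → v ≠ 0 → 0 < Aform φ x v v

/-- `σ_k` of a square matrix: the sum of its principal `k × k` minors
(equivalently, the `k`-th elementary symmetric function of its eigenvalues). -/
def sigmaMat {N : ℕ} (k : ℕ) (M : Matrix (Fin N) (Fin N) ℝ) : ℝ :=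
  ∑ s ∈ Finset.powersetCard k (Finset.univ : Finset (Fin N)),
    Matrix.det (Matrix.of fun i j : {a : Fin N // a ∈ s} => M i.1 j.1)

/-- `e` is an orthonormal frame of the tangent space of `𝕊ⁿ` at `x`. -/
def OrthoFrame {n : ℕ} (x : Euc n) (e : Fin n → Euc n) : Prop :=
  (∀ i, ⟪x, e i⟫ = 0) ∧ ∀ i j, ⟪e i, e j⟫ = if i = j then 1 else 0

/-- The matrix of `A[φ]` at `x` with respect to an orthonormal tangent frame `e`. -/
def Amat {n : ℕ} (φ : Euc n → ℝ) (x : Euc n) (e : Fin n → Euc n) : Matrix (Fin n) (Fin n) ℝ :=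
  Matrix.of fun i j => Aform φ x (e i) (e j)

/-- `φ` solves the horospherical `p`-Christoffel-Minkowski equation
`σ_k(A[φ]) = φ^(p-k) f` on `𝕊ⁿ`. -/
def SolvesCM (n k : ℕ) (p : ℝ) (f φ : Euc n → ℝ) : Prop :=
  ∀ x ∈ uSphere n, ∀ e : Fin n → Euc n, OrthoFrame x e →
    sigmaMat k (Amat φ x e) = φ x ^ (p - (k : ℝ)) * f x

/-- Supremum (maximum) of a function over the sphere. -/
def sphSup {n : ℕ} (f : Euc n → ℝ) : ℝ := sSup (f '' uSphere n)

/-- Infimum (minimum) of a function over the sphere. -/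
def sphInf {n : ℕ} (f : Euc n → ℝ) : ℝ := sInf (f '' uSphere n)

/-- The function `f^(-1/q)`. -/
def negPowExt {n : ℕ} (f : Euc n → ℝ) (q : ℝ) : Euc n → ℝ := fun y => f y ^ (-(1 / q))

/-- Assumption 1.3 of the paper (Assumption (A)): the gradient-and-Hessian conditions on the
prescribed function `f`, according to the value of `p`. -/
def AssumptionA (n k : ℕ) (p : ℝ) (f : Euc n → ℝ) : Prop :=
  ((p = 0) →
    ∀ x ∈ uSphere n, ∀ v : Euc n, ⟪x, v⟫ = 0 →
      0 ≤ hessS (negPowExt f (k : ℝ)) x v v - ‖gradS (negPowExt f (k : ℝ)) x‖ * ‖v‖ ^ 2 +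
          negPowExt f (k : ℝ) x /
              (2 + 8 * sphSup fun y => (f y / (n.choose k : ℝ)) ^ (1 / (k : ℝ))) * ‖v‖ ^ 2) ∧
  ((0 < p ∧ p ≤ (k : ℝ) / 2) →
    ∀ x ∈ uSphere n, ∀ v : Euc n, ⟪x, v⟫ = 0 →
      0 ≤ hessS (negPowExt f (k : ℝ)) x v v -
            (((k : ℝ) + 2 * p) / (k : ℝ)) * ‖gradS (negPowExt f (k : ℝ)) x‖ * ‖v‖ ^ 2 +
          (p ^ 2 / (k : ℝ) ^ 2) * negPowExt f (k : ℝ) x * ‖v‖ ^ 2) ∧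
  (((k : ℝ) / 2 < p ∧ p < (k : ℝ)) →
    ∀ x ∈ uSphere n, ∀ v : Euc n, ⟪x, v⟫ = 0 →
      0 ≤ hessS (negPowExt f (k : ℝ)) x v v -
            ((3 * (k : ℝ) - 2 * p) ^ 2 / (p * (2 * p - (k : ℝ)))) *
              (‖gradS (negPowExt f (k : ℝ)) x‖ ^ 2 / (2 * negPowExt f (k : ℝ) x)) * ‖v‖ ^ 2 +
          (p / (2 * (k : ℝ))) * negPowExt f (k : ℝ) x * ‖v‖ ^ 2) ∧
  (((k : ℝ) ≤ p ∧ p < 2 * (k : ℝ)) →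
    ∀ x ∈ uSphere n, ∀ v : Euc n, ⟪x, v⟫ = 0 →
      0 ≤ hessS (negPowExt f p) x v v -
            (‖gradS (negPowExt f p) x‖ ^ 2 / (2 * negPowExt f p x)) * ‖v‖ ^ 2 +
          (1 / 2) * negPowExt f p x * ‖v‖ ^ 2) ∧
  ((p = 2 * (k : ℝ)) →
    sphSup f < (n.choose k : ℝ) / 2 ^ k ∧
    ∀ x ∈ uSphere n, ∀ v : Euc n, ⟪x, v⟫ = 0 →
      0 ≤ hessS (negPowExt f p) x v v -
            (‖gradS (negPowExt f p) x‖ ^ 2 / (2 * negPowExt f p x)) * ‖v‖ ^ 2 +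
          (1 / 2) * negPowExt f p x * ‖v‖ ^ 2) ∧
  ((2 * (k : ℝ) < p) →
    2 ≤ k ∧
    sphInf f ≤
      (k : ℝ) ^ k * (p - 2 * (k : ℝ)) ^ ((p - 2 * (k : ℝ)) / 2) / p ^ (p / 2) * (n.choose k : ℝ) ∧
    ∀ x ∈ uSphere n, ∀ v : Euc n, ⟪x, v⟫ = 0 →
      0 ≤ hessS (negPowExt f p) x v v -
            (‖gradS (negPowExt f p) x‖ ^ 2 / (2 * negPowExt f p x)) * ‖v‖ ^ 2 +
          ((k : ℝ) / p) * negPowExt f p x * ‖v‖ ^ 2)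

/-- Comparison with the support functions `a + b cos(t - t₀)` of points, for a function satisfying
the one-dimensional h-convexity inequality and taking equal values at `0` and `π`. -/
theorem deriv_sq_add_one_le_sq_of_hconvex {h h₁ h₂ : ℝ → ℝ}
    (hd : ∀ t, HasDerivAt h (h₁ t) t) (hd₁ : ∀ t, HasDerivAt h₁ (h₂ t) t)
    (hpos : ∀ t, 0 < h t)
    (hconv : ∀ t, 0 ≤ h₂ t - h₁ t ^ 2 / (2 * h t) + (h t - (h t)⁻¹) / 2)
    (hper : h Real.pi = h 0) (h0 : 0 ≤ h₁ 0) : h₁ 0 ^ 2 + 1 ≤ h 0 ^ 2 := by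
  have hu (t : ℝ) : HasDerivAt (fun t : ℝ => Real.pi - t) (-1) t := by
    simpa using (hasDerivAt_id t).const_sub Real.pi
  have hu2 (t : ℝ) : HasDerivAt (fun t : ℝ => (Real.pi - t) / 2) (-1 / 2) t :=
    (hu t).div_const 2
  set B : ℝ → ℝ := fun t =>
    (h₁ t * Real.sin ((Real.pi - t) / 2) + h t * Real.cos ((Real.pi - t) / 2)) / √(h t) with hB
  have hsin {t : ℝ} (ht : t ∈ Set.Icc 0 Real.pi) : 0 ≤ Real.sin ((Real.pi - t) / 2) :=
    Real.sin_nonneg_of_nonneg_of_le_pi (by linarith [ht.2]) (by linarith [ht.1, Real.pi_pos])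
  have hBd (t : ℝ) : HasDerivAt B (Real.sin ((Real.pi - t) / 2) *
      ((h₂ t - h₁ t ^ 2 / (2 * h t) + (h t - (h t)⁻¹) / 2) + 1 / (2 * h t)) / √(h t)) t := by
    have hs : 0 < √(h t) := Real.sqrt_pos.2 (hpos t)
    have hsq : √(h t) ^ 2 = h t := Real.sq_sqrt (hpos t).le
    have := (((hd₁ t).mul (hu2 t).sin).add ((hd t).mul (hu2 t).cos)).div
      ((hd t).sqrt (hpos t).ne') hs.ne'
    refine this.congr_deriv ?_
    simp only [Pi.add_apply, Pi.mul_apply]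
    have hp := hpos t
    generalize √(h t) = s at hs hsq
    rw [← hsq]
    field_simp
    ring
  have hBmono : MonotoneOn B (Set.Icc 0 Real.pi) := by
    refine monotoneOn_of_hasDerivWithinAt_nonneg (convex_Icc _ _)
      (fun t _ => (hBd t).continuousAt.continuousWithinAt)
      (fun t _ => (hBd t).hasDerivWithinAt) fun t ht => ?_
    have := hpos t
    exact div_nonneg (mul_nonneg (hsin (interior_subset ht))
      (add_nonneg (hconv t) (by positivity))) (Real.sqrt_nonneg _)
  have hBnn {t : ℝ} (ht : t ∈ Set.Icc 0 Real.pi) :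
      0 ≤ h₁ t * Real.sin ((Real.pi - t) / 2) + h t * Real.cos ((Real.pi - t) / 2) := by
    have h1 : 0 ≤ B 0 := by
      simp only [hB, sub_zero, Real.sin_pi_div_two, Real.cos_pi_div_two]
      exact div_nonneg (by simpa using h0) (Real.sqrt_nonneg _)
    have h2 := h1.trans (hBmono (Set.left_mem_Icc.2 Real.pi_pos.le) ht ht.1)
    have hs : 0 < √(h t) := Real.sqrt_pos.2 (hpos t)
    simpa only [hB, div_mul_cancel₀ _ hs.ne', zero_mul] using
      mul_le_mul_of_nonneg_right h2 hs.le
  set a : ℝ → ℝ := fun t => (h₁ t ^ 2 + h t ^ 2 + 1) / (2 * h t) with ha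
  set G : ℝ → ℝ := fun t =>
    a t + (h t - a t) * Real.cos (Real.pi - t) + h₁ t * Real.sin (Real.pi - t) with hG
  have had (t : ℝ) : HasDerivAt a
      (h₁ t / h t * (h₂ t - h₁ t ^ 2 / (2 * h t) + (h t - (h t)⁻¹) / 2)) t := by
    have hp := hpos t
    have := ((((hd₁ t).pow 2).add ((hd t).pow 2)).add_const 1).div ((hd t).const_mul 2)
      (by positivity)
    refine this.congr_deriv ?_
    simp only [Pi.add_apply, Pi.pow_apply]
    field_simp
    norm_num
    ring
  have hGd (t : ℝ) : HasDerivAt G (2 * Real.sin ((Real.pi - t) / 2) *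
      (h₁ t * Real.sin ((Real.pi - t) / 2) + h t * Real.cos ((Real.pi - t) / 2)) / h t *
      (h₂ t - h₁ t ^ 2 / (2 * h t) + (h t - (h t)⁻¹) / 2)) t := by
    have hp := hpos t
    have := ((had t).add (((hd t).sub (had t)).mul (hu t).cos)).add ((hd₁ t).mul (hu t).sin)
    refine this.congr_deriv ?_
    have hc : Real.cos (Real.pi - t) = 1 - 2 * Real.sin ((Real.pi - t) / 2) ^ 2 := by
      have := Real.cos_two_mul ((Real.pi - t) / 2)
      rw [show 2 * ((Real.pi - t) / 2) = Real.pi - t by ring, Real.cos_sq'] at this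
      linarith
    have hs : Real.sin (Real.pi - t) =
        2 * Real.sin ((Real.pi - t) / 2) * Real.cos ((Real.pi - t) / 2) := by
      rw [← Real.sin_two_mul]
      congr 1
      ring
    simp only [Pi.sub_apply, hc, hs, ha]
    field_simp
    ring
  have hGmono : MonotoneOn G (Set.Icc 0 Real.pi) := by
    refine monotoneOn_of_hasDerivWithinAt_nonneg (convex_Icc _ _)
      (fun t _ => (hGd t).continuousAt.continuousWithinAt)
      (fun t _ => (hGd t).hasDerivWithinAt) fun t ht => ?_
    have ht' := interior_subset ht
    exact mul_nonneg (div_nonneg (mul_nonneg (mul_nonneg two_pos.le (hsin ht')) (hBnn ht'))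
      (hpos t).le) (hconv t)
  have key := hGmono (Set.left_mem_Icc.2 Real.pi_pos.le) (Set.right_mem_Icc.2 Real.pi_pos.le)
    Real.pi_pos.le
  simp only [hG, sub_zero, Real.cos_pi, Real.sin_pi, sub_self, Real.cos_zero, Real.sin_zero,
    hper] at key
  have h3 : a 0 ≤ h 0 := by linarith
  have hp := hpos 0
  simp only [ha] at h3
  rw [div_le_iff₀ (by positivity)] at h3
  nlinarith

section Sphere

variable {n : ℕ} {φ : Euc n → ℝ}

theorem tanProj_of_inner_eq_zero {x v : Euc n} (h : ⟪x, v⟫ = 0) : tanProj x v = v := by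
  simp [tanProj, h]

theorem ne_zero_of_mem_uSphere {x : Euc n} (hx : x ∈ uSphere n) : x ≠ 0 :=
  ne_zero_of_mem_unit_sphere (⟨x, hx⟩ : Metric.sphere (0 : Euc n) 1)

theorem SmoothFn.contDiffAt (hφ : SmoothFn φ) {y : Euc n} (hy : y ≠ 0) :
    ContDiffAt ℝ (⊤ : ℕ∞) φ y :=
  ContDiffOn.contDiffAt hφ (isOpen_ne.mem_nhds hy)

theorem SmoothFn.differentiableAt (hφ : SmoothFn φ) {y : Euc n} (hy : y ≠ 0) :
    DifferentiableAt ℝ φ y :=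
  (hφ.contDiffAt hy).differentiableAt (by simp)

theorem SmoothFn.differentiableAt_fderiv (hφ : SmoothFn φ) {y : Euc n} (hy : y ≠ 0) :
    DifferentiableAt ℝ (fderiv ℝ φ) y :=
  ((hφ.contDiffAt hy).fderiv_right (m := 1) (by norm_cast)).differentiableAt (by simp)

/-- Euler's identity in degree `0`. -/
theorem Homog0.fderiv_apply_self (h : Homog0 φ) (hφ : SmoothFn φ) {y : Euc n} (hy : y ≠ 0) :
    fderiv ℝ φ y y = 0 := by
  have h1 : HasDerivAt (fun c : ℝ => c • y) y 1 := by
    simpa using (hasDerivAt_id (1 : ℝ)).smul_const y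
  have h2 : HasDerivAt (fun c : ℝ => φ (c • y)) (fderiv ℝ φ y y) 1 :=
    HasFDerivAt.comp_hasDerivAt (1 : ℝ)
      (by simpa using (hφ.differentiableAt hy).hasFDerivAt) h1
  refine h2.unique ((hasDerivAt_const (1 : ℝ) (φ y)).congr_of_eventuallyEq ?_)
  filter_upwards [lt_mem_nhds (one_pos : (0 : ℝ) < 1)] with c hc using h c y hc

theorem Homog0.covD_eq (h : Homog0 φ) (hφ : SmoothFn φ) {y : Euc n} (hy : y ≠ 0) (v : Euc n) :
    covD φ y v = fderiv ℝ φ y v := by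
  simp [covD, tanProj, h.fderiv_apply_self hφ hy]

theorem Homog0.hessS_eq (h : Homog0 φ) (hφ : SmoothFn φ) {y v : Euc n} (hy : y ≠ 0)
    (hv : ⟪y, v⟫ = 0) (w : Euc n) : hessS φ y v w = fderiv ℝ (fderiv ℝ φ) y v w := by
  have he : (fun z => covD φ z w) =ᶠ[nhds y] fun z => fderiv ℝ φ z w := by
    filter_upwards [isOpen_ne.mem_nhds hy] with z hz using h.covD_eq hφ hz w
  rw [hessS, tanProj_of_inner_eq_zero hv, he.fderiv_eq]
  have := (hφ.differentiableAt_fderiv hy).hasFDerivAt.clm_apply (hasFDerivAt_const w y)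
  rw [this.fderiv]
  simp

theorem Homog0.gradS_eq (h : Homog0 φ) (hφ : SmoothFn φ) {y : Euc n} (hy : y ≠ 0) :
    gradS φ y = gradient φ y := by
  refine tanProj_of_inner_eq_zero ?_
  rw [real_inner_comm, gradient, InnerProductSpace.toDual_symm_apply]
  exact h.fderiv_apply_self hφ hy

theorem Homog0.inner_gradS (h : Homog0 φ) (hφ : SmoothFn φ) {y : Euc n} (hy : y ≠ 0)
    (v : Euc n) : ⟪gradS φ y, v⟫ = fderiv ℝ φ y v := by
  rw [h.gradS_eq hφ hy, gradient, InnerProductSpace.toDual_symm_apply]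

/-- The h-convexity inequality along a unit tangent direction. -/
theorem HConvex.hess_nonneg (hc : HConvex φ) (h : Homog0 φ) (hφ : SmoothFn φ) {y v : Euc n}
    (hy : y ∈ uSphere n) (hpos : 0 < φ y) (hv : ⟪y, v⟫ = 0) (hv1 : ‖v‖ = 1) :
    0 ≤ fderiv ℝ (fderiv ℝ φ) y v v - fderiv ℝ φ y v ^ 2 / (2 * φ y)
      + (φ y - (φ y)⁻¹) / 2 := by
  have hy0 := ne_zero_of_mem_uSphere hy
  have hA := hc y hy v hv
  rw [Aform, h.hessS_eq hφ hy0 hv, tanProj_of_inner_eq_zero hv, real_inner_self_eq_norm_sq,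
    hv1] at hA
  have hle : fderiv ℝ φ y v ^ 2 ≤ ‖gradS φ y‖ ^ 2 := by
    rw [← h.inner_gradS hφ hy0, sq_le_sq, abs_norm]
    simpa [hv1] using abs_real_inner_le_norm (gradS φ y) v
  have := div_le_div_of_nonneg_right hle (by positivity : 0 ≤ 2 * φ y)
  linarith

/-- The gradient bound in a single tangent direction. -/
theorem HConvex.fderiv_sq_add_one_le (hc : HConvex φ) (h : Homog0 φ) (hφ : SmoothFn φ)
    (he : EvenFn φ) (hpos : ∀ y ∈ uSphere n, 0 < φ y) {x e : Euc n} (hx : x ∈ uSphere n)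
    (hxe : ⟪x, e⟫ = 0) (he1 : ‖e‖ = 1) (hnn : 0 ≤ fderiv ℝ φ x e) :
    fderiv ℝ φ x e ^ 2 + 1 ≤ φ x ^ 2 := by
  have hx1 : ‖x‖ = 1 := by simpa [uSphere] using hx
  set γ : ℝ → Euc n := fun t => Real.cos t • x + Real.sin t • e with hγ
  set v : ℝ → Euc n := fun t => -Real.sin t • x + Real.cos t • e with hv
  have hγd (t : ℝ) : HasDerivAt γ (v t) t :=
    ((Real.hasDerivAt_cos t).smul_const x).add ((Real.hasDerivAt_sin t).smul_const e)
  have hvd (t : ℝ) : HasDerivAt v (-γ t) t := by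
    refine (((Real.hasDerivAt_sin t).neg.smul_const x).add
      ((Real.hasDerivAt_cos t).smul_const e)).congr_deriv ?_
    simp only [hγ]
    module
  have hex : ⟪e, x⟫ = 0 := by rw [real_inner_comm, hxe]
  have hxx : ⟪x, x⟫ = 1 := by rw [real_inner_self_eq_norm_sq, hx1, one_pow]
  have hee : ⟪e, e⟫ = 1 := by rw [real_inner_self_eq_norm_sq, he1, one_pow]
  have hγ1 (t : ℝ) : ‖γ t‖ = 1 := by
    rw [← sq_eq_sq₀ (norm_nonneg _) zero_le_one, ← real_inner_self_eq_norm_sq]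
    simp only [hγ, inner_add_left, inner_add_right, real_inner_smul_left, real_inner_smul_right,
      hxe, hex, hxx, hee]
    linarith [Real.sin_sq_add_cos_sq t]
  have hv1 (t : ℝ) : ‖v t‖ = 1 := by
    rw [← sq_eq_sq₀ (norm_nonneg _) zero_le_one, ← real_inner_self_eq_norm_sq]
    simp only [hv, inner_add_left, inner_add_right, real_inner_smul_left, real_inner_smul_right,
      hxe, hex, hxx, hee]
    linarith [Real.sin_sq_add_cos_sq t]
  have hγv (t : ℝ) : ⟪γ t, v t⟫ = 0 := by
    simp only [hγ, hv, inner_add_left, inner_add_right, real_inner_smul_left,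
      real_inner_smul_right, hxe, hex, hxx, hee]
    ring
  have hγs (t : ℝ) : γ t ∈ uSphere n := by simp [uSphere, hγ1 t]
  have hγ0 (t : ℝ) : γ t ≠ 0 := ne_zero_of_mem_uSphere (hγs t)
  have hd (t : ℝ) : HasDerivAt (fun t => φ (γ t)) (fderiv ℝ φ (γ t) (v t)) t :=
    (hφ.differentiableAt (hγ0 t)).hasFDerivAt.comp_hasDerivAt t (hγd t)
  have hd₁ (t : ℝ) : HasDerivAt (fun t => fderiv ℝ φ (γ t) (v t))
      (fderiv ℝ (fderiv ℝ φ) (γ t) (v t) (v t)) t := by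
    have := ((hφ.differentiableAt_fderiv (hγ0 t)).hasFDerivAt.comp_hasDerivAt t
      (hγd t)).clm_apply (hvd t)
    refine this.congr_deriv ?_
    simp [h.fderiv_apply_self hφ (hγ0 t)]
  have hγz : γ 0 = x := by simp [hγ]
  have hvz : v 0 = e := by simp [hv]
  have := deriv_sq_add_one_le_sq_of_hconvex hd hd₁ (fun t => hpos _ (hγs t))
    (fun t => hc.hess_nonneg h hφ (hγs t) (hpos _ (hγs t)) (hγv t) (hv1 t))
    (by simpa [hγ] using he x) (by simpa [hγz, hvz] using hnn)
  simpa [hγz, hvz] using this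

end Sphere

/-- **Gradient estimate** (Lemma 3.3 of Luo–Wei, Lemma 7.3 of Li–Xu): if `φ > 1` is a smooth,
even, h-convex function on `𝕊ⁿ` (e.g. the horospherical support function of a smooth,
origin-symmetric, uniformly h-convex hypersurface in `ℍ^{n+1}`), then
`|Dφ|²/φ² ≤ 1 - 1/φ² ≤ 1` at every point of `𝕊ⁿ`. -/
theorem gradient_estimate (n : ℕ) (φ : Euc n → ℝ)
    (hφ0 : Homog0 φ) (hφs : SmoothFn φ) (hφe : EvenFn φ)
    (hφ1 : ∀ x ∈ uSphere n, 1 < φ x) (hφc : HConvex φ) :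
    ∀ x ∈ uSphere n,
      ‖gradS φ x‖ ^ 2 / φ x ^ 2 ≤ 1 - 1 / φ x ^ 2 ∧ 1 - 1 / φ x ^ 2 ≤ 1 := by
  intro x hx
  have hφx := hφ1 x hx
  have hx0 := ne_zero_of_mem_uSphere hx
  have key : ‖gradS φ x‖ ^ 2 + 1 ≤ φ x ^ 2 := by
    by_cases hg : gradS φ x = 0
    · rw [hg, norm_zero]
      nlinarith
    have hg0 : ‖gradS φ x‖ ≠ 0 := norm_ne_zero_iff.2 hg
    have hfe : fderiv ℝ φ x (‖gradS φ x‖⁻¹ • gradS φ x) = ‖gradS φ x‖ := by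
      rw [← hφ0.inner_gradS hφs hx0, real_inner_smul_right, real_inner_self_eq_norm_sq]
      field_simp
    have horth : ⟪x, ‖gradS φ x‖⁻¹ • gradS φ x⟫ = 0 := by
      rw [real_inner_smul_right, real_inner_comm, hφ0.inner_gradS hφs hx0,
        hφ0.fderiv_apply_self hφs hx0, mul_zero]
    have := hφc.fderiv_sq_add_one_le hφ0 hφs hφe (fun y hy => one_pos.trans (hφ1 y hy)) hx horth
      (by rw [norm_smul, norm_inv, norm_norm, inv_mul_cancel₀ hg0])
      (by rw [hfe]; exact norm_nonneg _)
    rwa [hfe] at this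
  have hpos : 0 < φ x ^ 2 := by positivity
  refine ⟨?_, by linarith [div_pos one_pos hpos]⟩
  rw [le_sub_iff_add_le, ← add_div, div_le_one hpos]
  exact key
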